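/- Let V = (ZMod 8) ⊕ (ZMod 8), writing u_i := Sum.inl i and v_i := Sum.inr i (indices mod 8, so u_8 = u_0 and v_8 = v_0). Let ρ₁, ρ₂, ρ₃ : Equiv.Perm V be the permutations given in cycle notation by ρ₁ = (u₂ v₁ u₈)(u₃ v₆ v₈)(u₄ u₆ v₅)(u₇ v₂ v₄), ρ₂ = (u₁ v₃ u₅ v₇)(u₂ v₈ u₆ v₄)(u₃ v₅ u₇ v₁)(u₄ v₂ u₈ v₆), ρ₃ = (u₁ u₇ v₈)(u₂ v₇ v₅)(u₃ v₄ u₅)(u₆ v₃ v₁), with all unlisted points fixed. Then every non-identity element g of the subgroup of Equiv.Perm V generated by {ρ₁, ρ₂, ρ₃} that fixes at least one point of V has order 3. (Consequently no non-identity element of this subgroup fixes two adjacent vertices of P(8,3).) -/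

import Mathlib

namespace P83

/-- The outer vertex `u_i` of `P(8,3)` (indices mod 8, so `u 8 = u 0`). -/
def u (i : ℕ) : ZMod 8 ⊕ ZMod 8 := Sum.inl (i : ZMod 8)

/-- The inner vertex `v_i` of `P(8,3)` (indices mod 8, so `v 8 = v 0`). -/
def v (i : ℕ) : ZMod 8 ⊕ ZMod 8 := Sum.inr (i : ZMod 8)

/-- `ρ₁ = (u₂ v₁ u₈)(u₃ v₆ v₈)(u₄ u₆ v₅)(u₇ v₂ v₄)`. -/
def ρ₁ : Equiv.Perm (ZMod 8 ⊕ ZMod 8) :=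
  [u 2, v 1, u 8].formPerm * [u 3, v 6, v 8].formPerm *
    [u 4, u 6, v 5].formPerm * [u 7, v 2, v 4].formPerm

/-- `ρ₂ = (u₁ v₃ u₅ v₇)(u₂ v₈ u₆ v₄)(u₃ v₅ u₇ v₁)(u₄ v₂ u₈ v₆)`. -/
def ρ₂ : Equiv.Perm (ZMod 8 ⊕ ZMod 8) :=
  [u 1, v 3, u 5, v 7].formPerm * [u 2, v 8, u 6, v 4].formPerm *
    [u 3, v 5, u 7, v 1].formPerm * [u 4, v 2, u 8, v 6].formPerm

/-- `ρ₃ = (u₁ u₇ v₈)(u₂ v₇ v₅)(u₃ v₄ u₅)(u₆ v₃ v₁)`. -/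
def ρ₃ : Equiv.Perm (ZMod 8 ⊕ ZMod 8) :=
  [u 1, u 7, v 8].formPerm * [u 2, v 7, v 5].formPerm *
    [u 3, v 4, u 5].formPerm * [u 6, v 3, v 1].formPerm

/-- Number the vertices by `0, …, 15`. -/
def code : ZMod 8 ⊕ ZMod 8 → ℕ
  | Sum.inl i => i.val
  | Sum.inr i => 8 + i.val

/-- Table lookup. -/
def app (t : List ℕ) (n : ℕ) : ℕ := t.getD n 0

def idT : List ℕ := List.range 16
def t₁ : List ℕ := [2, 1, 9, 14, 6, 5, 13, 10, 3, 0, 12, 11, 7, 4, 8, 15]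
def t₂ : List ℕ := [14, 11, 8, 13, 10, 15, 12, 9, 6, 3, 0, 5, 2, 7, 4, 1]
def t₃ : List ℕ := [0, 7, 15, 12, 4, 3, 11, 8, 1, 6, 10, 9, 5, 2, 14, 13]

/-- Enlarge a list of tables by the products with the three generators. -/
def step (l : List (List ℕ)) : List (List ℕ) :=
  (l ++ l.map (·.map (app t₁)) ++ l.map (·.map (app t₂)) ++ l.map (·.map (app t₃))).dedup

/-- The tables of all elements of the group. -/
def tabs : List (List ℕ) := step (step (step (step (step (step [idT])))))

theorem code_injective : Function.Injective code := by
  unfold Function.Injective; decide +kernel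

theorem code_lt : ∀ x, code x < 16 := by decide +kernel

theorem code_ρ₁ : ∀ x, code (ρ₁ x) = app t₁ (code x) := by decide +kernel
theorem code_ρ₂ : ∀ x, code (ρ₂ x) = app t₂ (code x) := by decide +kernel
theorem code_ρ₃ : ∀ x, code (ρ₃ x) = app t₃ (code x) := by decide +kernel

theorem tabs_length : ∀ t ∈ tabs, t.length = 16 := by decide +kernel

theorem tabs_closed : ∀ t ∈ tabs, t.map (app t₁) ∈ tabs ∧ t.map (app t₂) ∈ tabs ∧
    t.map (app t₃) ∈ tabs := by decide +kernel

theorem tabs_order : ∀ t ∈ tabs, (∃ n < 16, app t n = n) →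
    ∀ n < 16, app t (app t (app t n)) = n := by decide +kernel

/-- `g` is described by one of the tables. -/
def Good (g : Equiv.Perm (ZMod 8 ⊕ ZMod 8)) : Prop :=
  ∃ t ∈ tabs, ∀ x, code (g x) = app t (code x)

theorem good_mul {y g : Equiv.Perm (ZMod 8 ⊕ ZMod 8)} {s : List ℕ}
    (hy : ∀ x, code (y x) = app s (code x)) (hs : ∀ t ∈ tabs, t.map (app s) ∈ tabs)
    (hg : Good g) : Good (y * g) := by
  obtain ⟨t, ht, h⟩ := hg
  refine ⟨t.map (app s), hs t ht, fun x => ?_⟩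
  have hl : code x < t.length := by rw [tabs_length t ht]; exact code_lt x
  rw [Equiv.Perm.mul_apply, hy, h]
  simp [app, hl]

theorem good_gen {y g : Equiv.Perm (ZMod 8 ⊕ ZMod 8)}
    (hy : y ∈ ({ρ₁, ρ₂, ρ₃} : Set (Equiv.Perm (ZMod 8 ⊕ ZMod 8)))) (hg : Good g) :
    Good (y * g) := by
  rcases hy with rfl | rfl | rfl
  · exact good_mul code_ρ₁ (fun t ht => (tabs_closed t ht).1) hg
  · exact good_mul code_ρ₂ (fun t ht => (tabs_closed t ht).2.1) hg
  · exact good_mul code_ρ₃ (fun t ht => (tabs_closed t ht).2.2) hg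

theorem gen_pow {y : Equiv.Perm (ZMod 8 ⊕ ZMod 8)}
    (hy : y ∈ ({ρ₁, ρ₂, ρ₃} : Set (Equiv.Perm (ZMod 8 ⊕ ZMod 8)))) : y ^ 12 = 1 := by
  have key : ∀ (y : Equiv.Perm (ZMod 8 ⊕ ZMod 8)) (s : List ℕ),
      (∀ x, code (y x) = app s (code x)) →
      (∀ n < 16, (app s)^[12] n = n) → y ^ 12 = 1 := by
    intro y s h hs
    ext x : 1
    apply code_injective
    have := hs (code x) (code_lt x)
    simp only [Function.iterate_succ, Function.iterate_zero, Function.comp, id] at this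
    simp only [pow_succ, pow_zero, Equiv.Perm.mul_apply, h, Equiv.Perm.one_apply, this]
  rcases hy with rfl | rfl | rfl
  · exact key _ _ code_ρ₁ (by decide +kernel)
  · exact key _ _ code_ρ₂ (by decide +kernel)
  · exact key _ _ code_ρ₃ (by decide +kernel)

theorem good_inv {y g : Equiv.Perm (ZMod 8 ⊕ ZMod 8)}
    (hy : y ∈ ({ρ₁, ρ₂, ρ₃} : Set (Equiv.Perm (ZMod 8 ⊕ ZMod 8)))) (hg : Good g) :
    Good (y⁻¹ * g) := by
  have h : y⁻¹ = y ^ 11 := by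
    rw [inv_eq_iff_mul_eq_one, ← pow_succ', gen_pow hy]
  have hn : ∀ n : ℕ, Good (y ^ n * g) := by
    intro n
    induction n with
    | zero => simpa using hg
    | succ k ih => rw [pow_succ', mul_assoc]; exact good_gen hy ih
  rw [h]; exact hn 11

theorem good_of_mem {g : Equiv.Perm (ZMod 8 ⊕ ZMod 8)}
    (hg : g ∈ Subgroup.closure {ρ₁, ρ₂, ρ₃}) : Good g := by
  induction hg using Subgroup.closure_induction_left with
  | one => exact ⟨idT, by decide +kernel, by decide +kernel⟩
  | mul_left y hy x _ ih => exact good_gen hy ih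
  | inv_mul_cancel y hy x _ ih => exact good_inv hy ih

/-- Every non-identity element of the subgroup `⟨ρ₁, ρ₂, ρ₃⟩ ≅ SL(2,3) ⋊ Z₂` of the permutation
group of the vertices of `P(8,3)` that fixes at least one vertex has order `3`. -/
theorem order_three_of_fixes_vertex (g : Equiv.Perm (ZMod 8 ⊕ ZMod 8))
    (hg : g ∈ Subgroup.closure {ρ₁, ρ₂, ρ₃}) (hg1 : g ≠ 1)
    (hfix : ∃ x : ZMod 8 ⊕ ZMod 8, g x = x) :
    orderOf g = 3 := by
  obtain ⟨t, ht, h⟩ := good_of_mem hg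
  obtain ⟨x, hx⟩ := hfix
  have h3 := tabs_order t ht ⟨code x, code_lt x, by rw [← h, hx]⟩
  haveI : Fact (Nat.Prime 3) := ⟨Nat.prime_three⟩
  refine orderOf_eq_prime ?_ hg1
  ext y : 1
  apply code_injective
  simp only [pow_succ, pow_zero, Equiv.Perm.mul_apply, h, Equiv.Perm.one_apply]
  exact h3 _ (code_lt y)

end P83
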